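/- arXiv:1912.11763 — 2 statements merged into one kernel-verified Lean document; each statement's English description precedes it below -/
import Mathlib

section
/- Let h be a Hessenberg function for type C_n, and for each i = 1,…,n fix a permutation w^{(i)} of the set {i+1, i+2, …, h(i)}. Then the classes ∏_{i=1}^{n} α^{C}_{i,w^{(i)}(h(i))}·α^{C}_{i,w^{(i)}(h(i)−1)}···α^{C}_{i,w^{(i)}(h(i)−m_i+1)}, indexed by tuples (m_1,…,m_n) with 0 ≤ m_i ≤ h(i)−i (an empty product being 1), form a basis of the ℝ-vector space R^{C}_{h} = ℝ[x_1,…,x_n]/(f^{C}_{1,h(1)},…,f^{C}_{n,h(n)}). -/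
open MvPolynomial

noncomputable section

/-- The variable `x_k` (1-indexed) of `ℝ[x_1,…,x_n]`. -/
def xv (n : ℕ) (k : ℕ) : MvPolynomial (Fin n) ℝ :=
  if h : 1 ≤ k ∧ k ≤ n then X ⟨k - 1, by omega⟩ else 0

/-- The type `C_n` root label `α^{C}_{i,j}`: `x_i − x_j` for `i+1 ≤ j ≤ n`,
`x_i + x_{2n+1−j}` for `n+1 ≤ j ≤ 2n−i`, and `2x_i` for `j = 2n+1−i`. -/
def alC (n i j : ℕ) : MvPolynomial (Fin n) ℝ :=
  if j ≤ n then xv n i - xv n j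
  else if j ≤ 2 * n - i then xv n i + xv n (2 * n + 1 - j)
  else 2 * xv n i

/-- The polynomial `f^{C}_{i,j} = Σ_{k=1}^{i}(∏_{ℓ=i+1}^{j} α^{C}_{k,ℓ})·x_k`. -/
def fCij (n i j : ℕ) : MvPolynomial (Fin n) ℝ :=
  ∑ k ∈ Finset.Icc 1 i, (∏ ℓ ∈ Finset.Icc (i + 1) j, alC n k ℓ) * xv n k

/-- The ideal `(f^{C}_{1,h(1)}, …, f^{C}_{n,h(n)})`,
so that `R^{C}_h = ℝ[x_1,…,x_n]/ICh n h ≅ H^*(Hess(N,h);ℝ)` in type `C_n`. -/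
def ICh (n : ℕ) (h : ℕ → ℕ) : Ideal (MvPolynomial (Fin n) ℝ) :=
  Ideal.span ((fun i => fCij n i (h i)) '' Set.Icc 1 n)

/-- The class of `∏_{i=1}^{n} α^{C}_{i,w⁽ⁱ⁾(h(i))}···α^{C}_{i,w⁽ⁱ⁾(h(i)−m_i+1)}` in
`R^{C}_h`. -/
def basCh (n : ℕ) (h : ℕ → ℕ) (w : ℕ → Equiv.Perm ℕ)
    (m : (i : Fin n) → Fin (h (i.val + 1) - (i.val + 1) + 1)) :
    MvPolynomial (Fin n) ℝ ⧸ ICh n h :=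
  Ideal.Quotient.mk (ICh n h)
    (∏ i : Fin n, ∏ t ∈ Finset.range (m i : ℕ),
      alC n (i.val + 1) (w (i.val + 1) (h (i.val + 1) - t)))

/-! ### Homogeneous systems of parameters -/

section HomogeneousSystem

variable {σ K : Type*} [Field K]

/-- The component of degree `N` of `f * q`, for `f` homogeneous of degree `e`. -/
theorem homogeneousComponent_mul_of_isHomogeneous {f : MvPolynomial σ K} {e : ℕ}
    (hf : f.IsHomogeneous e) (q : MvPolynomial σ K) (N : ℕ) :
    homogeneousComponent N (f * q) =
      if e ≤ N then f * homogeneousComponent (N - e) q else 0 := by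
  let _ : GradedAlgebra (homogeneousSubmodule σ K) := MvPolynomial.gradedAlgebra
  have hdec : ∀ (p : MvPolynomial σ K) (k : ℕ),
      (DirectSum.decompose (homogeneousSubmodule σ K) p k : MvPolynomial σ K) =
        homogeneousComponent k p := fun p k => decomposition.decompose'_apply p k
  simp only [← hdec]
  exact DirectSum.coe_decompose_mul_of_left_mem _ N ((mem_homogeneousSubmodule e f).2 hf)

variable [Fintype σ]

/-- The product of powers of the `f i` and of some `b m` attached to the exponent vector `a`,
divided with remainder by the vector of the degrees `d i + 1`. -/
def divModProduct (d : σ → ℕ) (f : σ → MvPolynomial σ K)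
    (b : ((i : σ) → Fin (d i + 1)) → MvPolynomial σ K) (a : σ →₀ ℕ) : MvPolynomial σ K :=
  (∏ i, f i ^ (a i / (d i + 1))) *
    b fun i => ⟨a i % (d i + 1), Nat.mod_lt _ (Nat.succ_pos _)⟩

/-- The linear endomorphism of the polynomial ring sending the monomial `x ^ a` to
`divModProduct d f b a`. -/
def divModMap (d : σ → ℕ) (f : σ → MvPolynomial σ K)
    (b : ((i : σ) → Fin (d i + 1)) → MvPolynomial σ K) :
    MvPolynomial σ K →ₗ[K] MvPolynomial σ K :=
  (basisMonomials σ K).constr K (divModProduct d f b)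

variable {d : σ → ℕ} {f : σ → MvPolynomial σ K}
  {b : ((i : σ) → Fin (d i + 1)) → MvPolynomial σ K}

theorem divModMap_monomial (a : σ →₀ ℕ) :
    divModMap d f b (monomial a 1) = divModProduct d f b a := by
  have key := (basisMonomials σ K).constr_basis K (divModProduct d f b) a
  rwa [coe_basisMonomials] at key

theorem divModMap_monomial_of_fin (m : (i : σ) → Fin (d i + 1)) :
    divModMap d f b (monomial (Finsupp.equivFunOnFinite.symm fun i => (m i : ℕ)) 1) = b m := by
  rw [divModMap_monomial, divModProduct, Finset.prod_eq_one, one_mul]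
  · congr 1
    funext i
    ext
    simp [Nat.mod_eq_of_lt (m i).isLt]
  · intro i _
    simp [Nat.div_eq_of_lt (m i).isLt]

theorem divModMap_X_pow_mul (i : σ) (u : MvPolynomial σ K) :
    divModMap d f b (X i ^ (d i + 1) * u) = f i * divModMap d f b u := by
  classical
  have key : divModMap d f b ∘ₗ LinearMap.mulLeft K (X i ^ (d i + 1)) =
      LinearMap.mulLeft K (f i) ∘ₗ divModMap d f b := by
    refine (basisMonomials σ K).ext fun a => ?_
    simp only [coe_basisMonomials, LinearMap.comp_apply, LinearMap.mulLeft_apply]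
    rw [X_pow_eq_monomial, monomial_mul, one_mul, divModMap_monomial, divModMap_monomial,
      divModProduct, divModProduct, ← mul_assoc]
    congr 1
    · rw [← Finset.mul_prod_erase _ _ (Finset.mem_univ i),
        ← Finset.mul_prod_erase _ (fun j => f j ^ (a j / (d j + 1))) (Finset.mem_univ i),
        ← mul_assoc]
      congr 1
      · simp [Nat.add_div_left, pow_succ']
      · refine Finset.prod_congr rfl fun j hj => ?_
        simp [Finsupp.single_eq_of_ne (Finset.ne_of_mem_erase hj)]
    · congr 1
      funext j
      ext
      by_cases hj : j = i
      · subst hj; simp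
      · simp [Finsupp.single_eq_of_ne hj]
  exact LinearMap.congr_fun key u

theorem isHomogeneous_divModProduct (hf : ∀ i, (f i).IsHomogeneous (d i + 1))
    (hb : ∀ m, (b m).IsHomogeneous (∑ i, (m i : ℕ))) (a : σ →₀ ℕ) :
    (divModProduct d f b a).IsHomogeneous a.degree := by
  have key := (IsHomogeneous.prod Finset.univ (fun i => f i ^ (a i / (d i + 1))) _
    fun i _ => (hf i).pow _).mul
      (hb fun i => ⟨a i % (d i + 1), Nat.mod_lt _ (Nat.succ_pos _)⟩)
  rw [← Finset.sum_add_distrib] at key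
  simp only [Nat.div_add_mod, ← Finsupp.degree_eq_sum] at key
  exact key

theorem divModMap_homogeneousComponent (hf : ∀ i, (f i).IsHomogeneous (d i + 1))
    (hb : ∀ m, (b m).IsHomogeneous (∑ i, (m i : ℕ))) (N : ℕ) (u : MvPolynomial σ K) :
    divModMap d f b (homogeneousComponent N u) = homogeneousComponent N (divModMap d f b u) := by
  have key : divModMap d f b ∘ₗ homogeneousComponent N =
      homogeneousComponent N ∘ₗ divModMap d f b := by
    refine (basisMonomials σ K).ext fun a => ?_
    simp only [coe_basisMonomials, LinearMap.comp_apply]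
    rw [homogeneousComponent_of_mem
        ((mem_homogeneousSubmodule _ _).2 (isHomogeneous_monomial (1 : K) rfl)),
      divModMap_monomial, homogeneousComponent_of_mem
        ((mem_homogeneousSubmodule _ _).2 (isHomogeneous_divModProduct hf hb a))]
    split_ifs
    · exact divModMap_monomial a
    · exact map_zero _
  exact LinearMap.congr_fun key u

theorem divModMap_surjective (hf : ∀ i, (f i).IsHomogeneous (d i + 1))
    (hb : ∀ m, (b m).IsHomogeneous (∑ i, (m i : ℕ)))
    (hspan : ∀ p, ∃ s ∈ Submodule.span K (Set.range b), p - s ∈ Ideal.span (Set.range f)) :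
    Function.Surjective (divModMap d f b) := by
  have hbT : Submodule.span K (Set.range b) ≤ LinearMap.range (divModMap d f b) := by
    rw [Submodule.span_le]
    rintro _ ⟨m, rfl⟩
    exact ⟨_, divModMap_monomial_of_fin m⟩
  have hom : ∀ N p, homogeneousComponent N p ∈ LinearMap.range (divModMap d f b) := by
    intro N
    induction N using Nat.strong_induction_on with
    | _ N ih =>
      intro p
      obtain ⟨s, hs, hps⟩ := hspan p
      obtain ⟨c, hc⟩ := (Ideal.mem_span_range_iff_exists_fun).1 hps
      have hp : p = s + ∑ i, f i * c i := by
        rw [← sub_eq_iff_eq_add', ← hc]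
        exact Finset.sum_congr rfl fun i _ => mul_comm _ _
      rw [hp, map_add, map_sum]
      refine add_mem ?_ (sum_mem fun i _ => ?_)
      · obtain ⟨u, rfl⟩ := hbT hs
        exact ⟨_, divModMap_homogeneousComponent hf hb N u⟩
      · rw [homogeneousComponent_mul_of_isHomogeneous (hf i)]
        split_ifs with hi
        · obtain ⟨u, hu⟩ := ih (N - (d i + 1)) (by omega) (c i)
          exact ⟨X i ^ (d i + 1) * u, by rw [divModMap_X_pow_mul, hu]⟩
        · exact zero_mem _
  intro p
  rw [← LinearMap.mem_range, ← sum_homogeneousComponent p]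
  exact sum_mem fun N _ => hom N p

theorem divModMap_injective (hf : ∀ i, (f i).IsHomogeneous (d i + 1))
    (hb : ∀ m, (b m).IsHomogeneous (∑ i, (m i : ℕ)))
    (hsurj : Function.Surjective (divModMap d f b)) :
    Function.Injective (divModMap d f b) := by
  rw [← LinearMap.ker_eq_bot, LinearMap.ker_eq_bot']
  intro u hu
  rw [← sum_homogeneousComponent u]
  refine Finset.sum_eq_zero fun N _ => ?_
  have hmaps : ∀ p ∈ homogeneousSubmodule σ K N,
      divModMap d f b p ∈ homogeneousSubmodule σ K N := by
    intro p hp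
    rw [← homogeneousComponent_eq_self hp, divModMap_homogeneousComponent hf hb]
    exact homogeneousComponent_mem _ _
  have : Module.Finite K (homogeneousSubmodule σ K N) :=
    Module.Finite.iff_fg.2 (homogeneousSubmodule_fg σ K N)
  have hinj : Function.Injective ((divModMap d f b).restrict hmaps) := by
    rw [LinearMap.injective_iff_surjective]
    rintro ⟨q, hq⟩
    obtain ⟨p, rfl⟩ := hsurj q
    refine ⟨⟨homogeneousComponent N p, homogeneousComponent_mem _ _⟩, Subtype.ext ?_⟩
    rw [LinearMap.coe_restrict_apply, divModMap_homogeneousComponent hf hb]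
    exact homogeneousComponent_eq_self hq
  have hzero : (⟨homogeneousComponent N u, homogeneousComponent_mem _ _⟩ :
      homogeneousSubmodule σ K N) = 0 := by
    apply hinj
    apply Subtype.ext
    rw [LinearMap.coe_restrict_apply, divModMap_homogeneousComponent hf hb, hu]
    simp
  exact congrArg Subtype.val hzero

/-- If the quotient of a polynomial ring by as many homogeneous polynomials as there are
variables is spanned by homogeneous classes with the multiset of degrees expected of a complete
intersection, then these classes are linearly independent. -/
theorem linearIndependent_of_forall_exists_span (hf : ∀ i, (f i).IsHomogeneous (d i + 1))
    (hb : ∀ m, (b m).IsHomogeneous (∑ i, (m i : ℕ)))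
    (hspan : ∀ p, ∃ s ∈ Submodule.span K (Set.range b), p - s ∈ Ideal.span (Set.range f)) :
    LinearIndependent K fun m => Ideal.Quotient.mk (Ideal.span (Set.range f)) (b m) := by
  classical
  have hsurj := divModMap_surjective hf hb hspan
  have hinj := divModMap_injective hf hb hsurj
  rw [Fintype.linearIndependent_iff]
  intro c hc m
  have hmem : ∑ m, c m • b m ∈ Ideal.span (Set.range f) := by
    rw [← Ideal.Quotient.eq_zero_iff_mem, ← hc, map_sum]
    exact Finset.sum_congr rfl fun m _ => Submodule.Quotient.mk_smul _ _ _
  obtain ⟨q, hq⟩ := (Ideal.mem_span_range_iff_exists_fun).1 hmem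
  choose u hu using fun i => hsurj (q i)
  let e : ((i : σ) → Fin (d i + 1)) → σ →₀ ℕ := fun m =>
    Finsupp.equivFunOnFinite.symm fun i => (m i : ℕ)
  have heq : ∑ m, c m • monomial (e m) (1 : K) = ∑ i, X i ^ (d i + 1) * u i := by
    apply hinj
    rw [map_sum, map_sum]
    simp only [map_smul, divModMap_X_pow_mul, hu, e, divModMap_monomial_of_fin]
    rw [← hq]
    exact Finset.sum_congr rfl fun i _ => mul_comm _ _
  have he : Function.Injective e := fun m m' hmm => by
    funext i
    ext
    simpa [e] using DFunLike.congr_fun hmm i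
  have hcoeff := congrArg (coeff (e m)) heq
  rw [coeff_sum, coeff_sum, Finset.sum_eq_single m, Finset.sum_eq_zero] at hcoeff
  · simpa using hcoeff
  · intro i _
    rw [X_pow_eq_monomial, coeff_monomial_mul', if_neg]
    intro hle
    have := hle i
    have := (m i).isLt
    simp [e] at *
    omega
  · intro m' _ hm'
    rw [coeff_smul, coeff_monomial, if_neg fun h => hm' (he h), smul_zero]
  · simp

end HomogeneousSystem

/-! ### Homogeneity of the roots -/

theorem isHomogeneous_xv (n k : ℕ) : (xv n k).IsHomogeneous 1 := by
  unfold xv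
  split_ifs
  · exact isHomogeneous_X _ _
  · exact isHomogeneous_zero _ _ _

theorem isHomogeneous_alC (n i j : ℕ) : (alC n i j).IsHomogeneous 1 := by
  unfold alC
  split_ifs
  · exact (isHomogeneous_xv n i).sub (isHomogeneous_xv n j)
  · exact (isHomogeneous_xv n i).add (isHomogeneous_xv n _)
  · rw [two_mul]
    exact (isHomogeneous_xv n i).add (isHomogeneous_xv n i)

theorem isHomogeneous_prod_alC {ι : Type*} (n i : ℕ) (s : Finset ι) (φ : ι → ℕ) :
    (∏ t ∈ s, alC n i (φ t)).IsHomogeneous s.card := by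
  have key := IsHomogeneous.prod s (fun t => alC n i (φ t)) (fun _ => 1)
    fun t _ => isHomogeneous_alC n i (φ t)
  simpa using key

theorem isHomogeneous_fCij {n i j : ℕ} : (fCij n i j).IsHomogeneous (j - i + 1) := by
  refine IsHomogeneous.sum _ _ _ fun k _ => ?_
  have key := (isHomogeneous_prod_alC n k (Finset.Icc (i + 1) j) id).mul (isHomogeneous_xv n k)
  simpa using key

/-! ### Spanning -/

/-- The variables extended to indices `1, …, 2n` by `x_{2n+1-ℓ} = -x_ℓ`. -/
def yv (n ℓ : ℕ) : MvPolynomial (Fin n) ℝ :=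
  if ℓ ≤ n then xv n ℓ else -xv n (2 * n + 1 - ℓ)

theorem yv_of_le {n ℓ : ℕ} (hℓ : ℓ ≤ n) : yv n ℓ = xv n ℓ := if_pos hℓ

theorem yv_reflect {n ℓ : ℕ} (h1 : 1 ≤ ℓ) (h2 : ℓ ≤ 2 * n) :
    yv n (2 * n + 1 - ℓ) = -yv n ℓ := by
  unfold yv
  by_cases hℓ : ℓ ≤ n
  · rw [if_neg (by omega), if_pos hℓ, show 2 * n + 1 - (2 * n + 1 - ℓ) = ℓ by omega]
  · rw [if_pos (by omega), if_neg hℓ, neg_neg]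

theorem alC_eq_sub_yv {n k j ℓ : ℕ} (hkj : k ≤ j) (hℓ : ℓ ≤ 2 * n + 1 - j) :
    alC n k ℓ = xv n k - yv n ℓ := by
  unfold alC yv
  split_ifs with h1 h2
  · rfl
  · rw [sub_neg_eq_add]
  · rw [sub_neg_eq_add, two_mul, show 2 * n + 1 - ℓ = k by omega]

/-- Modulo `J`, each of the variables `x_k`, `k < j`, is zero or one of the extended variables
with index in `[j, h(j)]`. -/
def IsSpecialization (n : ℕ) (h : ℕ → ℕ) (j : ℕ) (J : Ideal (MvPolynomial (Fin n) ℝ)) : Prop :=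
  ∀ k, 1 ≤ k → k < j → xv n k ∈ J ∨
    ∃ m, j ≤ m ∧ m ≤ h j ∧ m ≤ 2 * n + 1 - j ∧ xv n k - yv n m ∈ J

/-- The conditions on a Hessenberg function of type `C_n`. -/
structure IsHessenbergC (n : ℕ) (h : ℕ → ℕ) : Prop where
  le : ∀ i, 1 ≤ i → i ≤ n → i ≤ h i
  le_max : ∀ i, 1 ≤ i → i ≤ n → h i ≤ 2 * n + 1 - i
  mono : ∀ i, 1 ≤ i → i < n → h i ≠ 2 * n + 1 - i → h i ≤ h (i + 1)
  max_succ : ∀ i, 1 ≤ i → i < n → h i = 2 * n + 1 - i → h (i + 1) = 2 * n - i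

section Spanning

variable {n : ℕ} {h : ℕ → ℕ} {j : ℕ} {J : Ideal (MvPolynomial (Fin n) ℝ)}

theorem mem_of_two_mul_mem {p : MvPolynomial (Fin n) ℝ} (hp : 2 * p ∈ J) : p ∈ J := by
  have key := J.mul_mem_left (C (1 / 2 : ℝ)) hp
  rwa [← mul_assoc, show (2 : MvPolynomial (Fin n) ℝ) = C 2 from (map_ofNat C 2).symm, ← C_mul,
    show (1 / 2 : ℝ) * 2 = 1 by norm_num, C_1, one_mul] at key

/-- A specialization extends by `x_j = 0`. -/
theorem IsSpecialization.sup_xv (hH : IsHessenbergC n h) (hj1 : 1 ≤ j) (hjn : j ≤ n)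
    (hJ : IsSpecialization n h j J) :
    IsSpecialization n h (j + 1) (J ⊔ Ideal.span {xv n j}) := by
  have hle : J ≤ J ⊔ Ideal.span {xv n j} := le_sup_left
  have hx : xv n j ∈ J ⊔ Ideal.span {xv n j} :=
    Ideal.mem_sup_right (Ideal.mem_span_singleton_self _)
  intro k hk1 hkj
  obtain rfl | hkj : k = j ∨ k < j := by omega
  · exact Or.inl hx
  obtain hk | ⟨m, hjm, hmh, hmn, hk⟩ := hJ k hk1 hkj
  · exact Or.inl (hle hk)
  obtain rfl | hjm : m = j ∨ j < m := by omega
  · rw [yv_of_le hjn] at hk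
    exact Or.inl ((Submodule.sub_mem_iff_left _ hx).1 (hle hk))
  by_cases hmax : h j = 2 * n + 1 - j
  · obtain rfl | hm : m = 2 * n + 1 - j ∨ m < 2 * n + 1 - j := by omega
    · rw [yv_reflect hj1 (by omega), yv_of_le hjn] at hk
      exact Or.inl ((Submodule.sub_mem_iff_left _ (neg_mem hx)).1 (hle hk))
    · have := hH.max_succ j hj1 (by omega) hmax
      exact Or.inr ⟨m, by omega, by omega, by omega, hle hk⟩
  · have := hH.le_max j hj1 hjn
    have := hH.mono j hj1 (by omega) hmax
    exact Or.inr ⟨m, by omega, by omega, by omega, hle hk⟩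

/-- A specialization extends by `x_j = y_ℓ`. -/
theorem IsSpecialization.sup_alC (hH : IsHessenbergC n h) (hj1 : 1 ≤ j) (hjn : j ≤ n)
    (hJ : IsSpecialization n h j J) {ℓ : ℕ} (hjℓ : j < ℓ) (hℓ : ℓ ≤ h j) :
    IsSpecialization n h (j + 1) (J ⊔ Ideal.span {alC n j ℓ}) := by
  have hhj := hH.le_max j hj1 hjn
  rw [alC_eq_sub_yv le_rfl (hℓ.trans hhj)]
  have hle : J ≤ J ⊔ Ideal.span {xv n j - yv n ℓ} := le_sup_left
  have hx : xv n j - yv n ℓ ∈ J ⊔ Ideal.span {xv n j - yv n ℓ} :=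
    Ideal.mem_sup_right (Ideal.mem_span_singleton_self _)
  by_cases hℓm : ℓ = 2 * n + 1 - j
  · have hxj : xv n j ∈ J ⊔ Ideal.span {xv n j - yv n ℓ} := by
      apply mem_of_two_mul_mem
      have hy : yv n ℓ = -xv n j := by rw [hℓm, yv_reflect hj1 (by omega), yv_of_le hjn]
      convert hx using 1
      rw [hy, sub_neg_eq_add, two_mul]
    have hsub : J ⊔ Ideal.span {xv n j} ≤ J ⊔ Ideal.span {xv n j - yv n ℓ} :=
      sup_le le_sup_left ((Ideal.span_singleton_le_iff_mem _).2 hxj)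
    intro k hk1 hkj
    obtain hk | ⟨m, h1, h2, h3, hk⟩ := hJ.sup_xv hH hj1 hjn k hk1 hkj
    · exact Or.inl (hsub hk)
    · exact Or.inr ⟨m, h1, h2, h3, hsub hk⟩
  have hbound : h j = 2 * n + 1 - j ∧ h (j + 1) = 2 * n - j ∨
      h j < 2 * n + 1 - j ∧ h j ≤ h (j + 1) := by
    by_cases hmax : h j = 2 * n + 1 - j
    · exact Or.inl ⟨hmax, hH.max_succ j hj1 (by omega) hmax⟩
    · exact Or.inr ⟨by omega, hH.mono j hj1 (by omega) hmax⟩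
  intro k hk1 hkj
  obtain rfl | hkj : k = j ∨ k < j := by omega
  · exact Or.inr ⟨ℓ, by omega, by omega, by omega, hx⟩
  obtain hk | ⟨m, hjm, hmh, hmn, hk⟩ := hJ k hk1 hkj
  · exact Or.inl (hle hk)
  obtain rfl | hjm : m = j ∨ j < m := by omega
  · refine Or.inr ⟨ℓ, by omega, by omega, by omega, ?_⟩
    rw [yv_of_le hjn] at hk
    simpa using add_mem (hle hk) hx
  obtain rfl | hm : m = 2 * n + 1 - j ∨ m < 2 * n + 1 - j := by omega
  · refine Or.inr ⟨2 * n + 1 - ℓ, by omega, by omega, by omega, ?_⟩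
    rw [yv_reflect hj1 (by omega), yv_of_le hjn] at hk
    rw [yv_reflect (by omega) (by omega)]
    convert sub_mem (hle hk) hx using 1
    ring
  · exact Or.inr ⟨m, by omega, by omega, by omega, hle hk⟩

/-- Modulo a specialization, the summands of `f_{j,h(j)}` are `0` or equal to the last one. -/
theorem IsSpecialization.fCij_summand (hH : IsHessenbergC n h) (hj1 : 1 ≤ j) (hjn : j ≤ n)
    (hJ : IsSpecialization n h j J) {k : ℕ} (hk1 : 1 ≤ k) (hkj : k < j) :
    (∏ ℓ ∈ Finset.Icc (j + 1) (h j), alC n k ℓ) * xv n k ∈ J ∨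
      (∏ ℓ ∈ Finset.Icc (j + 1) (h j), alC n k ℓ) * xv n k -
        (∏ ℓ ∈ Finset.Icc (j + 1) (h j), alC n j ℓ) * xv n j ∈ J := by
  have hhj := hH.le_max j hj1 hjn
  obtain hk | ⟨m, hjm, hmh, hmn, hk⟩ := hJ k hk1 hkj
  · exact Or.inl (J.mul_mem_left _ hk)
  obtain rfl | hjm : m = j ∨ j < m := by omega
  · right
    rw [yv_of_le hjn] at hk
    rw [← Ideal.Quotient.eq] at hk ⊢
    rw [map_mul, map_mul, map_prod, map_prod, hk]
    congr 1
    refine Finset.prod_congr rfl fun ℓ hℓ => ?_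
    rw [Finset.mem_Icc] at hℓ
    rw [alC_eq_sub_yv hkj.le (by omega), alC_eq_sub_yv le_rfl (by omega), map_sub, map_sub, hk]
  · left
    refine J.mul_mem_right _ (J.mem_of_dvd
      (Finset.dvd_prod_of_mem _ (Finset.mem_Icc.2 ⟨hjm, hmh⟩)) ?_)
    rwa [alC_eq_sub_yv hkj.le hmn]

/-- Modulo a specialization, `f_{j,h(j)}` is a unit multiple of a product of linear forms. -/
theorem IsSpecialization.prod_mem (hH : IsHessenbergC n h) (hj1 : 1 ≤ j) (hjn : j ≤ n)
    (hJ : IsSpecialization n h j J) {J' : Ideal (MvPolynomial (Fin n) ℝ)} (hJJ' : J ≤ J')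
    (hf : fCij n j (h j) ∈ J') :
    (∏ ℓ ∈ Finset.Icc (j + 1) (h j), alC n j ℓ) * xv n j ∈ J' := by
  set P := (∏ ℓ ∈ Finset.Icc (j + 1) (h j), alC n j ℓ) * xv n j with hP
  have hsum : ∀ i < j, ∃ c : ℕ, ∑ k ∈ Finset.Icc 1 i,
      (∏ ℓ ∈ Finset.Icc (j + 1) (h j), alC n k ℓ) * xv n k - (c : ℝ) • P ∈ J := by
    intro i
    induction i with
    | zero => exact fun _ => ⟨0, by simp⟩
    | succ i ih =>
      intro hi
      obtain ⟨c, hc⟩ := ih (by omega)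
      rw [Finset.sum_Icc_succ_top (by omega)]
      obtain hk | hk := hJ.fCij_summand hH hj1 hjn (k := i + 1) (by omega) hi
      · refine ⟨c, ?_⟩
        convert add_mem hc hk using 1
        ring
      · refine ⟨c + 1, ?_⟩
        convert add_mem hc hk using 1
        push_cast
        rw [add_smul, one_smul]
        ring
  obtain ⟨c, hc⟩ := hsum (j - 1) (by omega)
  have hfj : fCij n j (h j) = ∑ k ∈ Finset.Icc 1 (j - 1),
      (∏ ℓ ∈ Finset.Icc (j + 1) (h j), alC n k ℓ) * xv n k + P := by
    obtain ⟨i, rfl⟩ : ∃ i, j = i + 1 := ⟨j - 1, by omega⟩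
    rw [fCij, Finset.sum_Icc_succ_top (by omega), hP]
    rfl
  have hmem : ((c : ℝ) + 1) • P ∈ J' := by
    convert sub_mem hf (hJJ' hc) using 1
    rw [hfj, add_smul, one_smul]
    ring
  have hne : (c : ℝ) + 1 ≠ 0 := by positivity
  have key := Submodule.smul_of_tower_mem J' ((c : ℝ) + 1)⁻¹ hmem
  rwa [smul_smul, inv_mul_cancel₀ hne, one_smul] at key

/-- If all variables lie in `J`, then every polynomial is constant modulo `J`. -/
theorem sub_C_coeff_zero_mem (hJ : ∀ i, X i ∈ J) (p : MvPolynomial (Fin n) ℝ) :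
    p - C (coeff 0 p) ∈ J := by
  induction p using MvPolynomial.induction_on with
  | C a => simp
  | add p q hp hq =>
    convert add_mem hp hq using 1
    rw [coeff_add, C_add]
    ring
  | mul_X p i _ =>
    rw [coeff_mul_X', if_neg (by simp), C_0, sub_zero]
    exact J.mul_mem_left p (hJ i)

end Spanning

/-- The product `α_{i,w⁽ⁱ⁾(h(i))}···α_{i,w⁽ⁱ⁾(h(i)−m+1)}`. -/
def rootProduct (n : ℕ) (h : ℕ → ℕ) (w : ℕ → Equiv.Perm ℕ) (i m : ℕ) : MvPolynomial (Fin n) ℝ :=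
  ∏ t ∈ Finset.range m, alC n i (w i (h i - t))

/-- The span of the products of the `rootProduct n h w i (m i)` with `j ≤ i ≤ n`. -/
def rootSpan (n : ℕ) (h : ℕ → ℕ) (w : ℕ → Equiv.Perm ℕ) (j : ℕ) :
    Submodule ℝ (MvPolynomial (Fin n) ℝ) :=
  Submodule.span ℝ {p | ∃ m : ℕ → ℕ, (∀ i, m i ≤ h i - i) ∧
    p = ∏ i ∈ Finset.Icc j n, rootProduct n h w i (m i)}

section RootSpan

variable {n : ℕ} {h : ℕ → ℕ} {w : ℕ → Equiv.Perm ℕ} {j : ℕ}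

theorem rootProduct_mul_mem_rootSpan (hjn : j ≤ n) {m : ℕ} (hm : m ≤ h j - j)
    {s : MvPolynomial (Fin n) ℝ} (hs : s ∈ rootSpan n h w (j + 1)) :
    rootProduct n h w j m * s ∈ rootSpan n h w j := by
  induction hs using Submodule.span_induction with
  | mem s hs =>
    obtain ⟨μ, hμ, rfl⟩ := hs
    refine Submodule.subset_span ⟨Function.update μ j m, fun i => ?_, ?_⟩
    · by_cases hi : i = j
      · subst hi; simpa using hm
      · simpa [hi] using hμ i
    · rw [← Finset.mul_prod_Ioc_eq_prod_Icc hjn, Function.update_self]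
      congr 1
      refine Finset.prod_congr (by ext; simp) fun i hi => ?_
      rw [Function.update_of_ne]
      simp at hi
      omega
  | zero => simp
  | add s s' _ _ hs hs' => rw [mul_add]; exact add_mem hs hs'
  | smul c s _ hs => rw [mul_smul_comm]; exact Submodule.smul_mem _ c hs

theorem rootProduct_full
    (hw : ∀ ℓ ∈ Finset.Icc (j + 1) (h j), w j ℓ ∈ Finset.Icc (j + 1) (h j)) :
    rootProduct n h w j (h j - j) = ∏ ℓ ∈ Finset.Icc (j + 1) (h j), alC n j ℓ := by
  have hinj : Set.InjOn (fun t => w j (h j - t)) (Finset.range (h j - j)) := by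
    intro t ht t' ht' htt
    have := (w j).injective htt
    simp at ht ht'
    omega
  rw [rootProduct, ← Finset.prod_image (f := alC n j) hinj]
  congr 1
  refine Finset.eq_of_subset_of_card_le ?_ ?_
  · intro ℓ hℓ
    obtain ⟨t, ht, rfl⟩ := Finset.mem_image.1 hℓ
    rw [Finset.mem_range] at ht
    exact hw _ (Finset.mem_Icc.2 ⟨by omega, by omega⟩)
  · rw [Finset.card_image_of_injOn hinj]
    simp

/-- Modulo a specialization of `x_1, …, x_{j-1}` and `f_j, …, f_n`, every polynomial is a linear
combination of products of roots. -/
theorem exists_rootSpan_sub_mem (hH : IsHessenbergC n h)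
    (hw : ∀ i ∈ Finset.Icc 1 n, ∀ ℓ ∈ Finset.Icc (i + 1) (h i), w i ℓ ∈ Finset.Icc (i + 1) (h i))
    (hj1 : 1 ≤ j) (hjn : j ≤ n + 1) (J : Ideal (MvPolynomial (Fin n) ℝ))
    (hJ : IsSpecialization n h j J) (p : MvPolynomial (Fin n) ℝ) :
    ∃ s ∈ rootSpan n h w j,
      p - s ∈ J ⊔ Ideal.span ((fun i => fCij n i (h i)) '' Set.Icc j n) := by
  induction hjn using Nat.decreasingInduction generalizing J p with
  | self =>
    have hX : ∀ i, X i ∈ J := by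
      intro i
      obtain hi | ⟨m, h1, _, h2, _⟩ := hJ (i + 1) (by omega) (by omega)
      · rwa [xv, dif_pos ⟨by omega, by omega⟩] at hi
      · omega
    refine ⟨C (coeff 0 p), ?_, Ideal.mem_sup_left (sub_C_coeff_zero_mem hX p)⟩
    rw [← mul_one (C _), ← smul_eq_C_mul]
    exact Submodule.smul_mem _ _ (Submodule.subset_span ⟨fun _ => 0, by simp, by simp⟩)
  | of_succ j hj ih =>
    have hjn : j ≤ n := by omega
    have hwj := hw j (Finset.mem_Icc.2 ⟨hj1, hjn⟩)
    set F := Ideal.span ((fun i => fCij n i (h i)) '' Set.Icc j n)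
    have hF : Ideal.span ((fun i => fCij n i (h i)) '' Set.Icc (j + 1) n) ≤ F :=
      Ideal.span_mono (Set.image_mono (Set.Icc_subset_Icc_left (by omega)))
    have hstep : ∀ (β : MvPolynomial (Fin n) ℝ) (m : ℕ), m ≤ h j - j →
        IsSpecialization n h (j + 1) (J ⊔ Ideal.span {β}) → ∀ r, ∃ s ∈ rootSpan n h w j,
        rootProduct n h w j m * r - s ∈ J ⊔ F ⊔ Ideal.span {rootProduct n h w j m * β} := by
      intro β m hm hβ r
      obtain ⟨s, hs, hrs⟩ := ih (by omega) _ hβ r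
      refine ⟨_, rootProduct_mul_mem_rootSpan hjn hm hs, ?_⟩
      rw [← mul_sub]
      obtain ⟨u, hu, v, hv, huv⟩ := Submodule.mem_sup.1 hrs
      obtain ⟨a, ha, q, hq, hqu⟩ := Submodule.mem_sup.1 hu
      obtain ⟨q, rfl⟩ := Ideal.mem_span_singleton.1 hq
      rw [← huv, ← hqu, mul_add, mul_add, ← mul_assoc]
      refine add_mem (add_mem ?_ ?_) ?_
      · exact Ideal.mem_sup_left (Ideal.mem_sup_left (J.mul_mem_left _ ha))
      · exact Ideal.mem_sup_right (Ideal.mul_mem_right _ _ (Ideal.mem_span_singleton_self _))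
      · exact Ideal.mem_sup_left (Ideal.mem_sup_right (F.mul_mem_left _ (hF hv)))
    have hroots : ∀ m ≤ h j - j, ∃ s ∈ rootSpan n h w j,
        p - s ∈ J ⊔ F ⊔ Ideal.span {rootProduct n h w j m} := by
      intro m
      induction m with
      | zero => exact fun _ => ⟨0, zero_mem _, Ideal.mem_sup_right (by simp [rootProduct])⟩
      | succ m ihm =>
        intro hm
        obtain ⟨s, hs, hps⟩ := ihm (by omega)
        obtain ⟨u, hu, r, hr, hur⟩ := Submodule.mem_sup.1 hps
        obtain ⟨r, rfl⟩ := Ideal.mem_span_singleton.1 hr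
        have hℓ := Finset.mem_Icc.1 (hwj (h j - m) (Finset.mem_Icc.2 ⟨by omega, by omega⟩))
        obtain ⟨s', hs', hrs⟩ := hstep (alC n j (w j (h j - m))) m (by omega)
          (hJ.sup_alC hH hj1 hjn (by omega) hℓ.2) r
        refine ⟨s + s', add_mem hs hs', ?_⟩
        rw [rootProduct, Finset.prod_range_succ, ← sub_sub, ← hur, add_sub_assoc]
        exact add_mem (Ideal.mem_sup_left hu) hrs
    obtain ⟨s, hs, hps⟩ := hroots _ le_rfl
    obtain ⟨u, hu, r, hr, hur⟩ := Submodule.mem_sup.1 hps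
    obtain ⟨r, rfl⟩ := Ideal.mem_span_singleton.1 hr
    obtain ⟨s', hs', hrs⟩ := hstep (xv n j) (h j - j) le_rfl (hJ.sup_xv hH hj1 hjn) r
    refine ⟨s + s', add_mem hs hs', ?_⟩
    rw [← sub_sub, ← hur, add_sub_assoc]
    refine add_mem hu ?_
    have hfull : rootProduct n h w j (h j - j) * xv n j ∈ J ⊔ F := by
      rw [rootProduct_full hwj]
      exact hJ.prod_mem hH hj1 hjn le_sup_left
        (Ideal.mem_sup_right (Ideal.subset_span ⟨j, ⟨le_rfl, hjn⟩, rfl⟩))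
    rwa [sup_eq_left.2 ((Ideal.span_singleton_le_iff_mem _).2 hfull)] at hrs

end RootSpan

/-- **Theorem 5.11 (type C).** For a Hessenberg function `h` of type `C_n` and any choice of
permutations `w⁽ⁱ⁾` of `{i+1,…,h(i)}`, the classes
`∏_{i=1}^{n} α^{C}_{i,w⁽ⁱ⁾(h(i))}···α^{C}_{i,w⁽ⁱ⁾(h(i)−m_i+1)}`, `0 ≤ m_i ≤ h(i)−i`, form
an ℝ-basis of `H^*(Hess(N,h)) ≅ R^{C}_h`. -/
theorem stmt_6 (n : ℕ) (hn : 1 ≤ n) (h : ℕ → ℕ)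
    (hh1 : ∀ i ∈ Finset.Icc 1 n, i ≤ h i ∧ h i ≤ 2 * n + 1 - i)
    (hh2 : ∀ i ∈ Finset.Icc 1 (n - 1), h i ≠ 2 * n + 1 - i → h i ≤ h (i + 1))
    (hh3 : ∀ i ∈ Finset.Icc 1 (n - 1), h i = 2 * n + 1 - i → h (i + 1) = 2 * n + 1 - (i + 1))
    (w : ℕ → Equiv.Perm ℕ)
    (hw : ∀ i ∈ Finset.Icc 1 n, ∀ j ∈ Finset.Icc (i + 1) (h i),
      w i j ∈ Finset.Icc (i + 1) (h i)) :
    LinearIndependent ℝ (basCh n h w) ∧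
      Submodule.span ℝ (Set.range (basCh n h w)) = ⊤ := by
  classical
  let d : Fin n → ℕ := fun i => h (i.val + 1) - (i.val + 1)
  let f : Fin n → MvPolynomial (Fin n) ℝ := fun i => fCij n (i.val + 1) (h (i.val + 1))
  let b : ((i : Fin n) → Fin (d i + 1)) → MvPolynomial (Fin n) ℝ := fun m =>
    ∏ i : Fin n, rootProduct n h w (i.val + 1) (m i)
  have hf : ∀ i, (f i).IsHomogeneous (d i + 1) := fun i => isHomogeneous_fCij
  have hb : ∀ m, (b m).IsHomogeneous (∑ i, (m i : ℕ)) := fun m =>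
    IsHomogeneous.prod _ _ _ fun i _ => by
      simpa [rootProduct] using isHomogeneous_prod_alC n (i.val + 1) (Finset.range (m i))
        fun t => w (i.val + 1) (h (i.val + 1) - t)
  have hI : ICh n h = Ideal.span (Set.range f) := by
    rw [ICh]
    congr 1
    ext p
    constructor
    · rintro ⟨i, ⟨hi1, hin⟩, rfl⟩
      exact ⟨⟨i - 1, by omega⟩, by simp [f, Nat.sub_add_cancel hi1]⟩
    · rintro ⟨i, rfl⟩
      exact ⟨i.val + 1, ⟨by omega, by omega⟩, rfl⟩
  have hH : IsHessenbergC n h :=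
    { le := fun i h1 h2 => (hh1 i (Finset.mem_Icc.2 ⟨h1, h2⟩)).1
      le_max := fun i h1 h2 => (hh1 i (Finset.mem_Icc.2 ⟨h1, h2⟩)).2
      mono := fun i h1 h2 => hh2 i (Finset.mem_Icc.2 ⟨h1, by omega⟩)
      max_succ := fun i h1 h2 hi => by
        rw [hh3 i (Finset.mem_Icc.2 ⟨h1, by omega⟩) hi]
        omega }
  have hrange : rootSpan n h w 1 ≤ Submodule.span ℝ (Set.range b) := by
    rw [rootSpan, Submodule.span_le]
    rintro _ ⟨m, hm, rfl⟩
    refine Submodule.subset_span ⟨fun i => ⟨m (i.val + 1), Nat.lt_succ_of_le (hm _)⟩, ?_⟩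
    simp only [b]
    rw [Fin.prod_univ_eq_prod_range (fun i => rootProduct n h w (i + 1) (m (i + 1))) n,
      Finset.range_eq_Ico, Finset.prod_Ico_add' (fun i => rootProduct n h w i (m i)) 0 n 1]
    exact Finset.prod_congr (by ext; simp) fun _ _ => rfl
  have hspan : ∀ p, ∃ s ∈ Submodule.span ℝ (Set.range b), p - s ∈ ICh n h := by
    intro p
    obtain ⟨s, hs, hps⟩ := exists_rootSpan_sub_mem hH hw le_rfl (by omega) ⊥
      (fun k h1 h2 => by omega) p
    exact ⟨s, hrange hs, by rwa [bot_sup_eq] at hps⟩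
  have hbas : basCh n h w = fun m => Ideal.Quotient.mk (ICh n h) (b m) := rfl
  constructor
  · rw [hbas]
    rw [hI] at hspan ⊢
    exact linearIndependent_of_forall_exists_span hf hb hspan
  · rw [eq_top_iff]
    rintro q -
    obtain ⟨p, rfl⟩ := Ideal.Quotient.mk_surjective q
    obtain ⟨s, hs, hps⟩ := hspan p
    rw [Ideal.Quotient.eq.2 hps, hbas]
    have key := Submodule.mem_map_of_mem (f := (Ideal.Quotient.mkₐ ℝ (ICh n h)).toLinearMap) hs
    rw [Submodule.map_span, ← Set.range_comp] at key
    exact key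
end
end

section
/- Let h be a Hessenberg function for type G_2, and fix a permutation w^{(1)} of {2,…,h(1)} and a permutation w^{(2)} of {3,…,h(2)}. Then the classes ∏_{i=1}^{2} α_{i,w^{(i)}(h(i))}·α_{i,w^{(i)}(h(i)−1)}···α_{i,w^{(i)}(h(i)−m_i+1)}, indexed by pairs (m_1,m_2) with 0 ≤ m_1 ≤ h(1)−1 and 0 ≤ m_2 ≤ h(2)−2 (an empty product being 1), form a basis of the ℝ-vector space R^{G}_{h} = ℝ[x_1,x_2,x_3]/(f_{1,h(1)}, f_{2,h(2)}, f_{3,3}). -/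
open MvPolynomial

noncomputable section

/-- The type `G_2` root labels `α_{1,j}` for `j = 2,…,6`, in `ℝ[x_1,x_2,x_3]`. -/
def alG1 : ℕ → MvPolynomial (Fin 3) ℝ
  | 2 => X 0 - X 1
  | 3 => -X 0 + X 2
  | 4 => -X 1 + X 2
  | 5 => X 0 - 2 * X 1 + X 2
  | 6 => -X 0 - X 1 + 2 * X 2
  | _ => 0

/-- The type `G_2` root label `α_{2,3} = −2x_1+x_2+x_3`. -/
def alG2 (j : ℕ) : MvPolynomial (Fin 3) ℝ :=
  if j = 3 then -2 * X 0 + X 1 + X 2 else 0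

/-- `f_{1,j} = (∏_{ℓ=2}^{j} α_{1,ℓ})·(−x_2+x_3)` (in particular `f_{1,1} = −x_2+x_3`). -/
def fG1 (j : ℕ) : MvPolynomial (Fin 3) ℝ :=
  (∏ ℓ ∈ Finset.Icc 2 j, alG1 ℓ) * (-X 1 + X 2)

/-- `f_{2,2} = x_3` and `f_{2,3} = x_1²+x_2²+x_3²`. -/
def fG2 (j : ℕ) : MvPolynomial (Fin 3) ℝ :=
  if j = 2 then X 2 else X 0 ^ 2 + X 1 ^ 2 + X 2 ^ 2

/-- `f_{3,3} = x_1+x_2+x_3`. -/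
def fG3 : MvPolynomial (Fin 3) ℝ := X 0 + X 1 + X 2

/-- The ideal `(f_{1,h(1)}, f_{2,h(2)}, f_{3,3})`, so that
`R^{G}_h = ℝ[x_1,x_2,x_3]/IG h ≅ H^*(Hess(N,h);ℝ)` in type `G_2`. -/
def IG (h : ℕ → ℕ) : Ideal (MvPolynomial (Fin 3) ℝ) :=
  Ideal.span {fG1 (h 1), fG2 (h 2), fG3}

/-- The class of
`(α_{1,w⁽¹⁾(h(1))}···α_{1,w⁽¹⁾(h(1)−m_1+1)})·(α_{2,w⁽²⁾(h(2))}···α_{2,w⁽²⁾(h(2)−m_2+1)})`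
in `R^{G}_h`. -/
def basG (h : ℕ → ℕ) (w1 w2 : Equiv.Perm ℕ)
    (m : Fin (h 1 - 1 + 1) × Fin (h 2 - 2 + 1)) :
    MvPolynomial (Fin 3) ℝ ⧸ IG h :=
  Ideal.Quotient.mk (IG h)
    ((∏ t ∈ Finset.range (m.1 : ℕ), alG1 (w1 (h 1 - t))) *
      ∏ t ∈ Finset.range (m.2 : ℕ), alG2 (w2 (h 2 - t)))

open Finset in
/-- If every element of `R` is a combination of the `B k` modulo each `ℓ t`, and the product of the
`ℓ t` vanishes, then the products of prefixes of `ℓ` with the `B k` span `R`. -/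
lemma span_prefixProd_mul_eq_top {R κ : Type*} [CommRing R] [Algebra ℝ R] (n : ℕ) (ℓ : ℕ → R)
    (B : κ → R)
    (hB : ∀ t < n, ∀ r, ∃ v ∈ Submodule.span ℝ (Set.range B), ∃ s, r = v + ℓ t * s)
    (h0 : ∏ t ∈ range n, ℓ t = 0) :
    Submodule.span ℝ (Set.range fun m : Fin n × κ => (∏ t ∈ range (m.1 : ℕ), ℓ t) * B m.2) = ⊤ := by
  set V := Submodule.span ℝ
    (Set.range fun m : Fin n × κ => (∏ t ∈ range (m.1 : ℕ), ℓ t) * B m.2) with hV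
  have key : ∀ m ≤ n, ∀ r, (∏ t ∈ range m, ℓ t) * r ∈ V := by
    intro m hm
    induction hm using Nat.decreasingInduction with
    | self => intro r; simp [h0]
    | of_succ m hm ih =>
      intro r
      obtain ⟨v, hv, s, rfl⟩ := hB m hm r
      rw [mul_add, ← mul_assoc, ← prod_range_succ]
      refine V.add_mem ?_ (ih s)
      have : Submodule.span ℝ (Set.range B) ≤
          V.comap (LinearMap.mulLeft ℝ (∏ t ∈ range m, ℓ t)) := by
        rw [Submodule.span_le]
        rintro _ ⟨k, rfl⟩
        exact Submodule.subset_span ⟨(⟨m, hm⟩, k), rfl⟩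
      exact this hv
  exact eq_top_iff.2 fun r _ => by simpa using key 0 (Nat.zero_le n) r

open Finset in
/-- If the `B k` are linearly independent modulo `K + (ℓ t)` for each `t`, with `K` a prime ideal
not containing any `ℓ t`, then the products of prefixes of `ℓ` with the `B k` are linearly
independent modulo `K + (∏ ℓ t)`. -/
lemma eq_zero_of_sum_prefixProd_mul_sub_mem {P κ : Type*} [CommRing P] [Algebra ℝ P] [Fintype κ]
    (K : Ideal P) [K.IsPrime] (B : κ → P) (n : ℕ) (ℓ : ℕ → P) (hℓ : ∀ t < n, ℓ t ∉ K)
    (hB : ∀ t < n, ∀ (c : κ → ℝ) (r : P), ∑ k, c k • B k - ℓ t * r ∈ K → ∀ k, c k = 0)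
    (c : Fin n → κ → ℝ) (r : P)
    (h : ∑ m : Fin n, (∏ t ∈ range (m : ℕ), ℓ t) * ∑ k, c m k • B k
      - (∏ t ∈ range n, ℓ t) * r ∈ K) :
    ∀ m k, c m k = 0 := by
  induction n generalizing ℓ with
  | zero => exact fun m => m.elim0
  | succ n ih =>
    simp only [Fin.sum_univ_succ, Fin.val_zero, range_zero, prod_empty, one_mul, Fin.val_succ,
      prod_range_succ'] at h
    have e : ∑ m : Fin n, (∏ t ∈ range (m : ℕ), ℓ (t + 1)) * ℓ 0 * ∑ k, c m.succ k • B k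
        = ℓ 0 * ∑ m : Fin n, (∏ t ∈ range (m : ℕ), ℓ (t + 1)) * ∑ k, c m.succ k • B k := by
      rw [mul_sum]
      exact sum_congr rfl fun _ _ => by ring
    rw [e] at h
    have hc0 : ∀ k, c 0 k = 0 := by
      refine hB 0 n.succ_pos (c 0) ((∏ t ∈ range n, ℓ (t + 1)) * r
        - ∑ m : Fin n, (∏ t ∈ range (m : ℕ), ℓ (t + 1)) * ∑ k, c m.succ k • B k) ?_
      convert h using 1
      ring
    have hc := ih (fun t => ℓ (t + 1)) (fun t ht => hℓ _ (Nat.succ_lt_succ ht))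
      (fun t ht => hB _ (Nat.succ_lt_succ ht)) (fun m => c m.succ) (by
        refine (Ideal.IsPrime.mem_or_mem ‹K.IsPrime› (x := ℓ 0) ?_).resolve_left
          (hℓ 0 n.succ_pos)
        convert h using 1
        simp only [hc0, zero_smul, sum_const_zero]
        ring)
    exact fun m => Fin.cases hc0 hc m

/-- The simple root `α_{2,3}`. -/
def betaG : MvPolynomial (Fin 3) ℝ := -2 * X 0 + X 1 + X 2

/-- The root `α_{1,4} = f_{1,1}`. -/
def gammaG : MvPolynomial (Fin 3) ℝ := -X 1 + X 2

/-- The linear forms `a β + b γ`, where `b ≠ 0`, and `b ≠ 3 a` unless `h(2) = 3`. -/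
def IsFactorG (h : ℕ → ℕ) (ℓ : MvPolynomial (Fin 3) ℝ) : Prop :=
  ∃ a b : ℝ, b ≠ 0 ∧ (h 2 ≠ 3 → b ≠ 3 * a) ∧ ℓ = C a * betaG + C b * gammaG

lemma isFactorG_gammaG (h : ℕ → ℕ) : IsFactorG h gammaG :=
  ⟨0, 1, by norm_num, by norm_num, by simp⟩

lemma two_mul_C_half : 2 * C (1 / 2 : ℝ) = (1 : MvPolynomial (Fin 3) ℝ) := by
  rw [← map_ofNat C 2, ← C_mul]
  norm_num

lemma isFactorG_alG1 (h : ℕ → ℕ) (hh1 : h 1 ≤ 6) (hh4 : 3 ≤ h 1 → h 2 = 3) {j : ℕ} (hj : 2 ≤ j)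
    (hj' : j ≤ h 1) : IsFactorG h (alG1 j) := by
  have hC := two_mul_C_half
  have h3 : (C (3 / 2 : ℝ) : MvPolynomial (Fin 3) ℝ) = 3 * C (1 / 2 : ℝ) := by
    rw [← map_ofNat C 3, ← C_mul]
    norm_num
  have : j ≤ 6 := hj'.trans hh1
  interval_cases j
  · refine ⟨-(1 / 2), 1 / 2, by norm_num, by norm_num, ?_⟩
    simp only [alG1, betaG, gammaG, C_neg]
    linear_combination (X 1 - X 0) * hC
  · refine ⟨1 / 2, 1 / 2, by norm_num, by norm_num, ?_⟩
    simp only [alG1, betaG, gammaG]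
    linear_combination (X 0 - X 2) * hC
  · exact isFactorG_gammaG h
  · refine ⟨-(1 / 2), 3 / 2, by norm_num, by norm_num, ?_⟩
    simp only [alG1, betaG, gammaG, C_neg, h3]
    linear_combination (2 * X 1 - X 0 - X 2) * hC
  · refine ⟨1 / 2, 3 / 2, by norm_num, fun h2 => absurd (hh4 (by omega)) h2, ?_⟩
    simp only [alG1, betaG, gammaG, h3]
    linear_combination (X 0 + X 1 - 2 * X 2) * hC

lemma mk_C_mul_C_inv (I : Ideal (MvPolynomial (Fin 3) ℝ)) {b : ℝ} (hb : b ≠ 0) :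
    Ideal.Quotient.mk I (C b) * Ideal.Quotient.mk I (C b⁻¹) = 1 := by
  rw [← map_mul, ← C_mul, mul_inv_cancel₀ hb, C_1, map_one]

lemma exists_eq_add_betaG_add_mul {I : Ideal (MvPolynomial (Fin 3) ℝ)} (h3 : fG3 ∈ I)
    (h2 : fG2 3 ∈ I) {a b : ℝ} (hb : b ≠ 0) (r : MvPolynomial (Fin 3) ℝ ⧸ I) :
    ∃ (u v : ℝ) (s : MvPolynomial (Fin 3) ℝ ⧸ I), r = u • 1 + v • Ideal.Quotient.mk I betaG
      + Ideal.Quotient.mk I (C a * betaG + C b * gammaG) * s := by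
  obtain ⟨p, rfl⟩ := Ideal.Quotient.mk_surjective r
  have c1 := mk_C_mul_C_inv I hb
  have c6 := mk_C_mul_C_inv I (show (6 : ℝ) ≠ 0 by norm_num)
  have cd := mk_C_mul_C_inv I (show b ^ 2 + 3 * a ^ 2 ≠ 0 by positivity)
  have e3 := Ideal.Quotient.eq_zero_iff_mem.2 h3
  have e2 := Ideal.Quotient.eq_zero_iff_mem.2 h2
  have hsmul : ∀ (x : ℝ) y, x • y = Ideal.Quotient.mk I (C x) * y := fun x y =>
    Algebra.smul_def x y
  simp only [hsmul, mul_one]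
  set π := Ideal.Quotient.mk I
  simp only [fG3, fG2, betaG, gammaG, map_add, map_mul, map_pow, map_neg, map_ofNat,
    show (3 : ℕ) ≠ 2 by norm_num, if_false] at c6 cd e2 e3 ⊢
  set β := -2 * π (X 0) + π (X 1) + π (X 2) with hβ
  set γ := -π (X 1) + π (X 2) with hγ
  set ℓ := π (C a) * β + π (C b) * γ with hℓ
  have hβ2 : β ^ 2 = ℓ * (3 * π (C (b ^ 2 + 3 * a ^ 2)⁻¹) * (π (C a) * β - π (C b) * γ)) := by
    have hq : β ^ 2 + 3 * γ ^ 2 = 0 := by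
      rw [hβ, hγ]
      linear_combination 6 * e2 + (-2 * π (X 0) - 2 * π (X 1) - 2 * π (X 2)) * e3
    rw [hℓ]
    linear_combination (-β ^ 2) * cd + π (C (b ^ 2 + 3 * a ^ 2)⁻¹) * π (C b) ^ 2 * hq
  have hγβ : γ = π (C b⁻¹) * ℓ - π (C b⁻¹) * π (C a) * β := by
    rw [hℓ]
    linear_combination (-γ) * c1
  have hX : ∀ i, ∃ (u : ℝ) (v : MvPolynomial (Fin 3) ℝ ⧸ I), π (X i) = π (C u) * β + v * ℓ := by
    intro i
    fin_cases i
    · refine ⟨-2 * 6⁻¹, 0, ?_⟩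
      simp only [map_mul, map_neg, map_ofNat]
      rw [hβ]
      change π (X 0) = _
      linear_combination (-π (X 0)) * c6 + 2 * π (C 6⁻¹) * e3
    · refine ⟨6⁻¹ + 3 * 6⁻¹ * (b⁻¹ * a), -(3 * π (C 6⁻¹)) * π (C b⁻¹), ?_⟩
      simp only [map_mul, map_add, map_ofNat]
      change π (X 1) = _
      have : π (X 1) = π (C 6⁻¹) * β - 3 * π (C 6⁻¹) * γ := by
        rw [hβ, hγ]
        linear_combination (-π (X 1)) * c6 + 2 * π (C 6⁻¹) * e3
      linear_combination this - 3 * π (C 6⁻¹) * hγβ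
    · refine ⟨6⁻¹ - 3 * 6⁻¹ * (b⁻¹ * a), 3 * π (C 6⁻¹) * π (C b⁻¹), ?_⟩
      simp only [map_mul, map_sub, map_ofNat]
      change π (X 2) = _
      have : π (X 2) = π (C 6⁻¹) * β + 3 * π (C 6⁻¹) * γ := by
        rw [hβ, hγ]
        linear_combination (-π (X 2)) * c6 + 2 * π (C 6⁻¹) * e3
      linear_combination this + 3 * π (C 6⁻¹) * hγβ
  induction p using MvPolynomial.induction_on with
  | C x => exact ⟨x, 0, 0, by simp⟩
  | add p q hp hq =>
    obtain ⟨u, v, s, hp⟩ := hp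
    obtain ⟨u', v', s', hq⟩ := hq
    refine ⟨u + u', v + v', s + s', ?_⟩
    simp only [map_add]
    linear_combination hp + hq
  | mul_X p i hp =>
    obtain ⟨u, v, s, hp⟩ := hp
    obtain ⟨d, e, hi⟩ := hX i
    refine ⟨0, u * d, π (C u) * e + π (C v) * π (C d) * (3 * π (C (b ^ 2 + 3 * a ^ 2)⁻¹) *
      (π (C a) * β - π (C b) * γ)) + π (C v) * e * β + s * π (X i), ?_⟩
    simp only [map_zero, map_mul]
    linear_combination π (X i) * hp + (π (C u) + π (C v) * β) * hi + π (C v) * π (C d) * hβ2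

lemma exists_eq_add_mul {I : Ideal (MvPolynomial (Fin 3) ℝ)} (h3 : fG3 ∈ I)
    (h2 : fG2 2 ∈ I) {a b : ℝ} (hb : b ≠ 3 * a) (r : MvPolynomial (Fin 3) ℝ ⧸ I) :
    ∃ (u : ℝ) (s : MvPolynomial (Fin 3) ℝ ⧸ I), r = u • 1
      + Ideal.Quotient.mk I (C a * betaG + C b * gammaG) * s := by
  obtain ⟨p, rfl⟩ := Ideal.Quotient.mk_surjective r
  have c1 := mk_C_mul_C_inv I (sub_ne_zero.2 hb)
  have e3 := Ideal.Quotient.eq_zero_iff_mem.2 h3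
  have e2 := Ideal.Quotient.eq_zero_iff_mem.2 h2
  have hsmul : ∀ (x : ℝ) y, x • y = Ideal.Quotient.mk I (C x) * y := fun x y =>
    Algebra.smul_def x y
  simp only [hsmul, mul_one]
  set π := Ideal.Quotient.mk I
  simp only [fG3, fG2, betaG, gammaG, map_add, map_sub, map_mul, map_neg, map_ofNat,
    if_true] at c1 e2 e3 ⊢
  set ℓ := π (C a) * (-2 * π (X 0) + π (X 1) + π (X 2)) + π (C b) * (-π (X 1) + π (X 2)) with hℓ
  have h1 : π (X 1) = ℓ * -π (C (b - 3 * a)⁻¹) := by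
    rw [hℓ]
    linear_combination (-π (X 1)) * c1 - 2 * π (C a) * π (C (b - 3 * a)⁻¹) * e3
      + (3 * π (C a) + π (C b)) * π (C (b - 3 * a)⁻¹) * e2
  have hX : ∀ i, ∃ v, π (X i) = ℓ * v := by
    intro i
    fin_cases i
    · exact ⟨π (C (b - 3 * a)⁻¹), show π (X 0) = _ by linear_combination e3 - e2 - h1⟩
    · exact ⟨_, h1⟩
    · exact ⟨0, show π (X 2) = _ by linear_combination e2⟩
  induction p using MvPolynomial.induction_on with
  | C x => exact ⟨x, 0, by simp⟩
  | add p q hp hq =>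
    obtain ⟨u, s, hp⟩ := hp
    obtain ⟨u', s', hq⟩ := hq
    refine ⟨u + u', s + s', ?_⟩
    simp only [map_add]
    linear_combination hp + hq
  | mul_X p i _ =>
    obtain ⟨v, hi⟩ := hX i
    refine ⟨0, π p * v, ?_⟩
    simp only [map_zero, map_mul]
    linear_combination π p * hi

lemma mem_span_pow_add_mul {h : ℕ → ℕ} (hh2 : 2 ≤ h 2 ∧ h 2 ≤ 3)
    {I : Ideal (MvPolynomial (Fin 3) ℝ)} (h3 : fG3 ∈ I) (h2 : fG2 (h 2) ∈ I)
    {ℓ : MvPolynomial (Fin 3) ℝ} (hℓ : IsFactorG h ℓ) (r : MvPolynomial (Fin 3) ℝ ⧸ I) :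
    ∃ v ∈ Submodule.span ℝ (Set.range fun k : Fin (h 2 - 2 + 1) =>
      Ideal.Quotient.mk I (betaG ^ (k : ℕ))), ∃ s, r = v + Ideal.Quotient.mk I ℓ * s := by
  obtain ⟨a, b, hb, hab, rfl⟩ := hℓ
  have mem : ∀ k < h 2 - 2 + 1, Ideal.Quotient.mk I (betaG ^ k) ∈
      Submodule.span ℝ (Set.range fun k : Fin (h 2 - 2 + 1) =>
        Ideal.Quotient.mk I (betaG ^ (k : ℕ))) :=
    fun k hk => Submodule.subset_span ⟨⟨k, hk⟩, rfl⟩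
  have mem0 := mem 0 (by omega)
  rw [pow_zero, map_one] at mem0
  by_cases e : h 2 = 3
  · obtain ⟨u, v, s, hr⟩ := exists_eq_add_betaG_add_mul (a := a) h3 (by rwa [e] at h2) hb r
    have mem1 := mem 1 (by omega)
    rw [pow_one] at mem1
    exact ⟨_, Submodule.add_mem _ (Submodule.smul_mem _ u mem0) (Submodule.smul_mem _ v mem1),
      s, hr⟩
  · have e2 : h 2 = 2 := by omega
    obtain ⟨u, s, hr⟩ := exists_eq_add_mul h3 (by rwa [e2] at h2) (hab e) r
    exact ⟨_, Submodule.smul_mem _ u mem0, s, hr⟩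

/-- Evaluation along the line through a point `c`. -/
def lineEval {F : Type*} [Field F] [Algebra ℝ F] (c : Fin 3 → F) :
    MvPolynomial (Fin 3) ℝ →ₐ[ℝ] Polynomial F :=
  aeval fun i => Polynomial.C (c i) * Polynomial.X

lemma coeff_zero_lineEval {F : Type*} [Field F] [Algebra ℝ F] (c : Fin 3 → F)
    (r : MvPolynomial (Fin 3) ℝ) :
    (lineEval c r).coeff 0 = algebraMap ℝ F (constantCoeff r) := by
  induction r using MvPolynomial.induction_on with
  | C a => simp [lineEval, Polynomial.algebraMap_apply]
  | add p q hp hq => simp [hp, hq]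
  | mul_X p i hp => simp [lineEval, Polynomial.mul_coeff_zero]

lemma coeff_lineEval_sum_pow {F : Type*} [Field F] [Algebra ℝ F] (c : Fin 3 → F) {d : F}
    (hd : lineEval c betaG = Polynomial.C d * Polynomial.X) {N : ℕ} (x : Fin N → ℝ) (j : Fin N) :
    (lineEval c (∑ k, x k • betaG ^ (k : ℕ))).coeff j = algebraMap ℝ F (x j) * d ^ (j : ℕ) := by
  rw [map_sum, Polynomial.finsetSum_coeff, Finset.sum_eq_single j]
  · rw [map_smul, map_pow, hd, mul_pow, ← Polynomial.C_pow, Polynomial.coeff_smul,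
      Polynomial.coeff_C_mul_X_pow, if_pos rfl, Algebra.smul_def]
  · intro k _ hk
    rw [map_smul, map_pow, hd, mul_pow, ← Polynomial.C_pow, Polynomial.coeff_smul,
      Polynomial.coeff_C_mul_X_pow, if_neg fun e => hk (Fin.ext e.symm), smul_zero]
  · simp

/-- A prime ideal containing `f_{2,h(2)}` and `f_{3,3}`, modulo which the powers of `β` are
independent modulo every admissible linear form. -/
lemma exists_isPrime_forall_isFactorG {h : ℕ → ℕ} (hh2 : 2 ≤ h 2 ∧ h 2 ≤ 3) :
    ∃ K : Ideal (MvPolynomial (Fin 3) ℝ), K.IsPrime ∧ fG3 ∈ K ∧ fG2 (h 2) ∈ K ∧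
      ∀ ℓ, IsFactorG h ℓ → ℓ ∉ K ∧ ∀ (c : Fin (h 2 - 2 + 1) → ℝ) (r : MvPolynomial (Fin 3) ℝ),
        ∑ k, c k • betaG ^ (k : ℕ) - ℓ * r ∈ K → ∀ k, c k = 0 := by
  by_cases e : h 2 = 3
  · have hs : (√3 : ℂ) ^ 2 = 3 := by
      rw [← Complex.ofReal_pow, Real.sq_sqrt (by norm_num)]
      norm_num
    set φ := lineEval ![(-2 : ℂ), 1 - √3 * Complex.I, 1 + √3 * Complex.I] with hφ
    have hβ : φ betaG = Polynomial.C 6 * Polynomial.X := by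
      simp only [hφ, lineEval, betaG, map_add, map_mul, map_neg, map_ofNat, aeval_X,
        Matrix.cons_val, Polynomial.C_sub, map_one]
      ring
    have hγ : φ gammaG = Polynomial.C (2 * √3 * Complex.I) * Polynomial.X := by
      simp only [hφ, lineEval, gammaG, map_add, map_mul, map_neg, map_ofNat, aeval_X,
        Matrix.cons_val, Polynomial.C_sub, map_one]
      ring
    have hℓ : ∀ a b : ℝ, φ (C a * betaG + C b * gammaG)
        = Polynomial.C (a * 6 + b * (2 * √3 * Complex.I)) * Polynomial.X := by
      intro a b
      rw [map_add, map_mul, map_mul, hβ, hγ, ← algebraMap_eq, AlgHom.commutes, AlgHom.commutes]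
      simp only [Polynomial.algebraMap_apply, Complex.coe_algebraMap, Polynomial.C_add,
        Polynomial.C_mul]
      ring
    refine ⟨RingHom.ker φ, RingHom.ker_isPrime φ, ?_, ?_, ?_⟩
    · rw [RingHom.mem_ker]
      simp only [hφ, lineEval, fG3, map_add, map_sub, map_neg, map_one, map_ofNat, aeval_X,
        Matrix.cons_val]
      ring
    · rw [RingHom.mem_ker, e]
      simp only [hφ, lineEval, fG2, show (3 : ℕ) ≠ 2 by norm_num, if_false, map_add, map_pow,
        aeval_X, Matrix.cons_val, mul_pow]
      have : (-2 : ℂ) ^ 2 + (1 - √3 * Complex.I) ^ 2 + (1 + √3 * Complex.I) ^ 2 = 0 := by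
        linear_combination 2 * Complex.I ^ 2 * hs + 6 * Complex.I_sq
      have hC := congrArg Polynomial.C this
      simp only [Polynomial.C_add, Polynomial.C_pow, map_zero] at hC ⊢
      linear_combination Polynomial.X ^ 2 * hC
    · rintro _ ⟨a, b, hb, -, rfl⟩
      constructor
      · rw [RingHom.mem_ker, hℓ]
        intro h0
        have := congrArg (fun p => (Polynomial.coeff p 1).im) h0
        simp [hb] at this
      · intro c r hr
        rw [RingHom.mem_ker, map_sub, map_mul, hℓ, sub_eq_zero] at hr
        intro k
        have hk := congrArg (fun p => Polynomial.coeff p k) hr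
        simp only [hφ, coeff_lineEval_sum_pow _ hβ] at hk
        obtain hk0 | hk1 : (k : ℕ) = 0 ∨ (k : ℕ) = 1 := by omega
        · simpa [hk0, Polynomial.mul_coeff_zero] using hk
        · rw [hk1, mul_assoc, Polynomial.coeff_C_mul, Polynomial.coeff_X_mul,
            coeff_zero_lineEval] at hk
          have him := congrArg Complex.im hk
          have hre := congrArg Complex.re hk
          simp [hb] at him
          simpa [him] using hre
  · have e2 : h 2 = 2 := by omega
    set φ := lineEval ![(1 : ℝ), -1, 0] with hφ
    have hβ : φ betaG = Polynomial.C (-3) * Polynomial.X := by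
      simp only [hφ, lineEval, betaG, map_add, map_mul, map_neg, map_ofNat, aeval_X,
        Matrix.cons_val, map_one, map_zero]
      ring
    refine ⟨RingHom.ker φ, RingHom.ker_isPrime φ, ?_, ?_, ?_⟩
    · rw [RingHom.mem_ker]
      simp [hφ, lineEval, fG3]
    · rw [RingHom.mem_ker, e2]
      simp [hφ, lineEval, fG2]
    · rintro _ ⟨a, b, -, hab, rfl⟩
      have hℓ : φ (C a * betaG + C b * gammaG) = Polynomial.C (b - 3 * a) * Polynomial.X := by
        simp only [hφ, lineEval, betaG, gammaG, map_add, map_mul, map_neg, map_ofNat, aeval_X,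
          aeval_C, Matrix.cons_val, Polynomial.algebraMap_apply, Algebra.algebraMap_self,
          RingHom.id_apply, Polynomial.C_sub, map_one, map_zero]
        ring
      constructor
      · rw [RingHom.mem_ker, hℓ]
        exact mul_ne_zero (Polynomial.C_ne_zero.2 (sub_ne_zero.2 (hab e))) Polynomial.X_ne_zero
      · intro c r hr
        rw [RingHom.mem_ker, map_sub, map_mul, hℓ, sub_eq_zero] at hr
        intro k
        have hk := congrArg (fun p => Polynomial.coeff p k) hr
        simp only [hφ, coeff_lineEval_sum_pow _ hβ] at hk
        have hk0 : (k : ℕ) = 0 := by omega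
        simpa [hk0, Polynomial.mul_coeff_zero] using hk

open Finset in
lemma prod_range_alG1_perm (n : ℕ) (w : Equiv.Perm ℕ)
    (hw : ∀ j ∈ Icc 2 n, w j ∈ Icc 2 n) :
    ∏ t ∈ range (n - 1), alG1 (w (n - t)) = ∏ j ∈ Icc 2 n, alG1 j := by
  have e : ∏ t ∈ range (n - 1), alG1 (w (n - t)) = ∏ j ∈ Icc 2 n, alG1 (w j) := by
    refine prod_bij' (fun t _ => n - t) (fun j _ => n - j) ?_ ?_ ?_ ?_ fun _ _ => rfl <;>
      simp only [mem_range, mem_Icc] <;> omega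
  rw [e]
  have himg : (Icc 2 n).image w = Icc 2 n :=
    eq_of_subset_of_card_le (image_subset_iff.2 hw) (card_image_of_injective _ w.injective).ge
  conv_rhs => rw [← himg, prod_image w.injective.injOn]

lemma prod_range_alG2_perm {h : ℕ → ℕ} (hh2 : 2 ≤ h 2 ∧ h 2 ≤ 3) (w : Equiv.Perm ℕ)
    (hw : ∀ j ∈ Finset.Icc 3 (h 2), w j ∈ Finset.Icc 3 (h 2)) {k : ℕ} (hk : k < h 2 - 2 + 1) :
    ∏ t ∈ Finset.range k, alG2 (w (h 2 - t)) = betaG ^ k := by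
  rw [← Finset.card_range k, ← Finset.prod_const, Finset.card_range]
  refine Finset.prod_congr rfl fun t ht => ?_
  rw [Finset.mem_range] at ht
  have h23 : h 2 = 3 := by omega
  have hw3 := hw 3 (by simp [h23])
  rw [h23, Finset.mem_Icc] at hw3
  have : w (h 2 - t) = 3 := by
    rw [show h 2 - t = 3 by omega]
    omega
  simp [this, alG2, betaG]

/-- **Theorem 5.15 (type G₂).** For a Hessenberg function `h` of type `G_2` and permutations
`w⁽¹⁾` of `{2,…,h(1)}` and `w⁽²⁾` of `{3,…,h(2)}`, the classes
`∏_{i=1}^{2} α_{i,w⁽ⁱ⁾(h(i))}···α_{i,w⁽ⁱ⁾(h(i)−m_i+1)}` with `0 ≤ m_1 ≤ h(1)−1`,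
`0 ≤ m_2 ≤ h(2)−2` form an ℝ-basis of `H^*(Hess(N,h)) ≅ R^{G}_h`. -/
theorem stmt_7 (h : ℕ → ℕ)
    (hh1 : 1 ≤ h 1 ∧ h 1 ≤ 6) (hh2 : 2 ≤ h 2 ∧ h 2 ≤ 3) (hh3 : h 3 = 3)
    (hh4 : 3 ≤ h 1 → h 2 = 3)
    (w1 w2 : Equiv.Perm ℕ)
    (hw1 : ∀ j ∈ Finset.Icc 2 (h 1), w1 j ∈ Finset.Icc 2 (h 1))
    (hw2 : ∀ j ∈ Finset.Icc 3 (h 2), w2 j ∈ Finset.Icc 3 (h 2)) :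
    LinearIndependent ℝ (basG h w1 w2) ∧
      Submodule.span ℝ (Set.range (basG h w1 w2)) = ⊤ := by
  set ℓ : ℕ → MvPolynomial (Fin 3) ℝ :=
    fun t => if t < h 1 - 1 then alG1 (w1 (h 1 - t)) else gammaG with hℓ
  have hfac : ∀ t < h 1 - 1 + 1, IsFactorG h (ℓ t) := by
    intro t _
    simp only [hℓ]
    split_ifs with ht
    · have := hw1 (h 1 - t) (by rw [Finset.mem_Icc]; omega)
      rw [Finset.mem_Icc] at this
      exact isFactorG_alG1 h hh1.2 hh4 this.1 this.2
    · exact isFactorG_gammaG h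
  have hpre : ∀ m ≤ h 1 - 1, ∏ t ∈ Finset.range m, ℓ t
      = ∏ t ∈ Finset.range m, alG1 (w1 (h 1 - t)) := fun m hm =>
    Finset.prod_congr rfl fun t ht => if_pos ((Finset.mem_range.1 ht).trans_le hm)
  have hprod : ∏ t ∈ Finset.range (h 1 - 1 + 1), ℓ t = fG1 (h 1) := by
    rw [Finset.prod_range_succ, hpre _ le_rfl, prod_range_alG1_perm _ _ hw1]
    simp [hℓ, fG1, gammaG]
  have hbas : basG h w1 w2 = fun m => Ideal.Quotient.mk (IG h)
      ((∏ t ∈ Finset.range (m.1 : ℕ), ℓ t) * betaG ^ (m.2 : ℕ)) := by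
    funext m
    rw [basG, hpre _ (Nat.lt_succ_iff.1 m.1.2), prod_range_alG2_perm hh2 w2 hw2 m.2.2]
  have hf1 : fG1 (h 1) ∈ IG h := Ideal.subset_span (by simp)
  have hf2 : fG2 (h 2) ∈ IG h := Ideal.subset_span (by simp)
  have hf3 : fG3 ∈ IG h := Ideal.subset_span (by simp)
  rw [hbas]
  constructor
  · obtain ⟨K, hK, h3K, h2K, hKℓ⟩ := exists_isPrime_forall_isFactorG hh2
    rw [Fintype.linearIndependent_iff]
    intro c hc
    have hmem : ∑ m : Fin (h 1 - 1 + 1) × Fin (h 2 - 2 + 1),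
        c m • ((∏ t ∈ Finset.range (m.1 : ℕ), ℓ t) * betaG ^ (m.2 : ℕ)) ∈ IG h := by
      rw [← Ideal.Quotient.eq_zero_iff_mem, map_sum]
      exact hc
    rw [IG, Ideal.mem_span_insert] at hmem
    obtain ⟨r, z, hz, hsum⟩ := hmem
    have hzK : z ∈ K := by
      refine Ideal.span_le.2 ?_ hz
      rintro x (rfl | rfl)
      exacts [h2K, h3K]
    have := eq_zero_of_sum_prefixProd_mul_sub_mem K
      (fun k : Fin (h 2 - 2 + 1) => betaG ^ (k : ℕ)) (h 1 - 1 + 1) ℓ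
      (fun t ht => (hKℓ _ (hfac t ht)).1) (fun t ht => (hKℓ _ (hfac t ht)).2)
      (fun m k => c (m, k)) r (by
        rw [hprod]
        convert hzK using 1
        rw [Fintype.sum_prod_type] at hsum
        simp only [Finset.mul_sum, mul_smul_comm]
        rw [hsum]
        ring)
    exact fun m => this m.1 m.2
  · simp only [map_mul, map_prod]
    refine span_prefixProd_mul_eq_top (h 1 - 1 + 1) (fun t => Ideal.Quotient.mk (IG h) (ℓ t))
      (fun k : Fin (h 2 - 2 + 1) => Ideal.Quotient.mk (IG h) (betaG ^ (k : ℕ)))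
      (fun t ht r => mem_span_pow_add_mul hh2 hf3 hf2 (hfac t ht) r) ?_
    rw [← map_prod, hprod]
    exact Ideal.Quotient.eq_zero_iff_mem.2 hf1
end
end
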